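/- Fix ε > 0 and an integer k ≥ 1, and set K = 2^k. For each m let N = N(m) be any integer with K^m ≤ N < K^{m+1}. Then lim_{m→∞} P( max_{u ∈ V_N} H_{K^m}(u) ≤ ε log N ) = 1. -/

import Mathlib

open MeasureTheory ProbabilityTheory Real Set Filter

/-- The lattice ℤ². -/
abbrev Z2 := ℤ × ℤ

/-- Nearest-neighbor adjacency on ℤ². -/
def Adj (x y : Z2) : Prop := |x.1 - y.1| + |x.2 - y.2| = 1

/-- The `L^∞` distance on ℤ². -/
def linf (x y : Z2) : ℤ := max |x.1 - y.1| |x.2 - y.2|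

/-- The Euclidean distance on ℤ². -/
noncomputable def eZ (x y : Z2) : ℝ :=
  Real.sqrt (((x.1 - y.1 : ℤ) : ℝ) ^ 2 + ((x.2 - y.2 : ℤ) : ℝ) ^ 2)

/-- Inner boundary `∂B` of a set `B ⊆ ℤ²`: points of `B` having a nearest neighbor
outside `B`. -/
def bdry (B : Set Z2) : Set Z2 := {z | z ∈ B ∧ ∃ w, Adj z w ∧ w ∉ B}

/-- Number of nearest-neighbor paths of length `t` from `x` to `y` avoiding `∂B`. -/
noncomputable def nWalks (B : Set Z2) (t : ℕ) (x y : Z2) : ℕ :=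
  Nat.card {f : Fin (t + 1) → Z2 //
    f 0 = x ∧ f (Fin.last t) = y ∧ (∀ i, f i ∉ bdry B) ∧
    ∀ i : Fin t, Adj (f i.castSucc) (f i.succ)}

/-- The Green function of simple random walk on ℤ² killed upon hitting `∂B`:
`G_B(x,y) = E_x [∑_{t=0}^{τ-1} 1_{S_t = y}]`, where `τ` is the hitting time of `∂B`. -/
noncomputable def greenFn (B : Set Z2) (x y : Z2) : ℝ :=
  ∑' t : ℕ, (1 / 4 : ℝ) ^ t * nWalks B t x y

/-- A centered (jointly) Gaussian family: every finite linear combination is a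
centered Gaussian random variable. -/
def IsCenteredGaussianFamily {Ω : Type*} [MeasureSpace Ω] {ι : Type*} (f : ι → Ω → ℝ) : Prop :=
  ∀ (s : Finset ι) (c : ι → ℝ), ∃ v : NNReal,
    Measure.map (fun ω => ∑ i ∈ s, c i * f i ω) (ℙ : Measure Ω) = gaussianReal 0 v

/-- `η` is a discrete Gaussian free field on `B` with Dirichlet boundary conditions:
a centered Gaussian field, vanishing outside `B`, whose covariance on `B` is the
Green function of simple random walk killed at `∂B`. -/
def IsDGFF {Ω : Type*} [MeasureSpace Ω] (B : Set Z2) (η : Z2 → Ω → ℝ) : Prop :=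
  IsCenteredGaussianFamily (fun z : Z2 => η z) ∧
  (∀ z, z ∉ B → η z = 0) ∧
  (∀ x ∈ B, ∀ y ∈ B, ∫ ω, η x ω * η y ω = greenFn B x y)

/-- `F` is the harmonic extension of `η` from outside `B`: it agrees with `η` on
`B^c ∪ ∂B` and is discrete harmonic on `B ∖ ∂B`. -/
def IsHarmExt {Ω : Type*} [MeasureSpace Ω] (η F : Z2 → Ω → ℝ) (B : Set Z2) : Prop :=
  (∀ z, z ∉ B \ bdry B → F z = η z) ∧
  (∀ z ∈ B \ bdry B, ∀ ω, 4 * F z ω =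
    F (z.1 + 1, z.2) ω + F (z.1 - 1, z.2) ω + F (z.1, z.2 + 1) ω + F (z.1, z.2 - 1) ω)

/-- The box of side length `ℓ` centered at `x`. -/
def boxZ (x : Z2) (ℓ : ℤ) : Set Z2 :=
  {z | x.1 - ℓ / 2 ≤ z.1 ∧ z.1 ≤ x.1 + ℓ / 2 ∧ x.2 - ℓ / 2 ≤ z.2 ∧ z.2 ≤ x.2 + ℓ / 2}

/-- `V_N = [0,N)² ∩ ℤ²`. -/
def VN (N : ℕ) : Set Z2 := {z | 0 ≤ z.1 ∧ z.1 < (N : ℤ) ∧ 0 ≤ z.2 ∧ z.2 < (N : ℤ)}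

/-- `V_{5N} = [-2N, 3N)² ∩ ℤ²`. -/
def V5N (N : ℕ) : Set Z2 :=
  {z | -(2 * (N : ℤ)) ≤ z.1 ∧ z.1 < 3 * (N : ℤ) ∧ -(2 * (N : ℤ)) ≤ z.2 ∧ z.2 < 3 * (N : ℤ)}

/-- The field `η_j`: `η_0 = η^{V_{5N}} - H_K` and `η_j = H_{K^j} - H_{K^{j+1}}` for
`j ≥ 1`, where `H ℓ x` denotes the value at `x` of the harmonic extension of the
field `η` from outside the box of side `ℓ` centered at `x`. -/
def etaJ {Ω : Type*} (η : Z2 → Ω → ℝ) (H : ℤ → Z2 → Ω → ℝ) (K : ℕ) (j : ℕ) (x : Z2) :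
    Ω → ℝ :=
  if j = 0 then fun ω => η x ω - H (K : ℤ) x ω
  else fun ω => H ((K : ℤ) ^ j) x ω - H ((K : ℤ) ^ (j + 1)) x ω

/-- A path in `V` given as a nonempty list of vertices of `V` in which consecutive
vertices are nearest neighbors. -/
def LPathIn (V : Set Z2) (P : List Z2) : Prop :=
  P ≠ [] ∧ P.Chain' Adj ∧ ∀ z ∈ P, z ∈ V

/-- Sum over the four neighbours. -/
def nsum (F : Z2 → ℝ) (z : Z2) : ℝ :=
  F (z.1 + 1, z.2) + F (z.1 - 1, z.2) + F (z.1, z.2 + 1) + F (z.1, z.2 - 1)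

def nbrs (z : Z2) : Finset Z2 :=
  {(z.1 + 1, z.2), (z.1 - 1, z.2), (z.1, z.2 + 1), (z.1, z.2 - 1)}

lemma mem_nbrs (z w : Z2) : w ∈ nbrs z ↔ Adj z w := by
  obtain ⟨a, b⟩ := z
  obtain ⟨c, d⟩ := w
  simp only [nbrs, Adj, Finset.mem_insert, Finset.mem_singleton, Prod.mk.injEq]
  constructor
  · rintro (⟨rfl, rfl⟩ | ⟨rfl, rfl⟩ | ⟨rfl, rfl⟩ | ⟨rfl, rfl⟩) <;> simp
  · intro h
    rcases abs_cases (a - c) with h1 | h1 <;> rcases abs_cases (b - d) with h2 | h2 <;> omega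

lemma sum_nbrs (F : Z2 → ℝ) (z : Z2) : ∑ w ∈ nbrs z, F w = nsum F z := by
  unfold nbrs nsum
  rw [Finset.sum_insert, Finset.sum_insert, Finset.sum_insert, Finset.sum_singleton]
  · ring
  · simp; omega
  · simp
  · simp; omega

/-- Poisson kernel by successive elimination. -/
lemma poisson (B : Finset Z2) (D : Finset Z2) :
    D ⊆ B → (∀ z ∈ D, nbrs z ⊆ B) →
    ∃ h : Z2 → Z2 → ℝ, ∀ x ∈ B, (∀ z, 0 ≤ h x z) ∧ (∀ z ∈ D, h x z = 0) ∧
      ∀ F : Z2 → ℝ, (∀ z ∈ D, 4 * F z ≤ nsum F z) → F x ≤ ∑ z ∈ B, h x z * F z := by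
  induction D using Finset.induction_on with
  | empty =>
    intro _ _
    refine ⟨fun x z => if x = z then 1 else 0, fun x hx => ⟨fun z => ?_, by simp, fun F _ => ?_⟩⟩
    · dsimp only
      split_ifs <;> norm_num
    · simp [hx]
  | insert d D hd ih =>
    intro hDB hn
    obtain ⟨h, hh⟩ := ih (fun z hz => hDB (Finset.mem_insert_of_mem hz))
      (fun z hz => hn z (Finset.mem_insert_of_mem hz))
    have hdB : d ∈ B := hDB (Finset.mem_insert_self _ _)
    have hnd : nbrs d ⊆ B := hn d (Finset.mem_insert_self _ _)
    set q : Z2 → ℝ := fun z => (∑ y ∈ nbrs d, h y z) / 4 with hq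
    have hq0 : ∀ z, 0 ≤ q z := fun z =>
      div_nonneg (Finset.sum_nonneg fun y hy => (hh y (hnd hy)).1 z) (by norm_num)
    have key : ∀ F : Z2 → ℝ, (∀ z ∈ D, 4 * F z ≤ nsum F z) →
        nsum F d / 4 ≤ ∑ z ∈ B, q z * F z := by
      intro F hF
      have h1 : nsum F d ≤ ∑ y ∈ nbrs d, ∑ z ∈ B, h y z * F z := by
        rw [← sum_nbrs]
        exact Finset.sum_le_sum fun y hy => (hh y (hnd hy)).2.2 F hF
      rw [Finset.sum_comm] at h1
      have h2 : ∑ z ∈ B, q z * F z = (∑ z ∈ B, ∑ y ∈ nbrs d, h y z * F z) / 4 := by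
        rw [Finset.sum_div]
        refine Finset.sum_congr rfl fun z _ => ?_
        rw [hq, ← Finset.sum_mul]
        ring
      rw [h2]
      linarith
    have hsplit : ∀ g : Z2 → ℝ, ∑ z ∈ B, g z = g d + ∑ z ∈ B.erase d, g z :=
      fun g => (Finset.add_sum_erase B g hdB).symm
    have hsum : ∑ z ∈ B, q z ≤ 1 := by
      have := key (fun _ => -1) (fun z _ => by simp [nsum]; norm_num)
      simp [nsum] at this
      linarith
    have hp : q d < 1 := by
      by_contra hcon
      push Not at hcon
      rw [hsplit] at hsum
      have h0 : ∑ z ∈ B.erase d, q z = 0 :=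
        le_antisymm (by linarith) (Finset.sum_nonneg fun z _ => hq0 z)
      have hz := (Finset.sum_eq_zero_iff_of_nonneg (fun z _ => hq0 z)).1 h0
      have := key (fun z => ((z.1 : ℝ) - d.1) ^ 2 + ((z.2 : ℝ) - d.2) ^ 2)
        (fun z _ => by simp only [nsum]; push_cast; nlinarith)
      rw [hsplit, Finset.sum_eq_zero (fun z hz' => by rw [hz z hz', zero_mul])] at this
      simp only [nsum] at this
      push_cast at this
      ring_nf at this
      norm_num at this
    have hp' : 0 < 1 - q d := by linarith
    refine ⟨fun x z => if z = d then 0 else h x z + h x d * (q z / (1 - q d)),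
      fun x hx => ⟨fun z => ?_, fun z hz => ?_, fun F hF => ?_⟩⟩
    · dsimp only
      split_ifs
      · exact le_rfl
      · have a := (hh x hx).1 z
        have b := (hh x hx).1 d
        have c := hq0 z
        positivity
    · dsimp only
      split_ifs with hzd
      · rfl
      · have hzD : z ∈ D := by simpa [hzd] using hz
        have : q z = 0 := by
          simp only [hq]
          rw [Finset.sum_eq_zero (fun y hy => (hh y (hnd hy)).2.1 z hzD), zero_div]
        rw [(hh x hx).2.1 z hzD, this]
        simp
    · have hF' : ∀ z ∈ D, 4 * F z ≤ nsum F z := fun z hz => hF z (Finset.mem_insert_of_mem hz)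
      have h1 := (hh x hx).2.2 F hF'
      have h2 := key F hF'
      have h3 := hF d (Finset.mem_insert_self _ _)
      rw [hsplit] at h1 h2 ⊢
      have h4 : F d ≤ (∑ z ∈ B.erase d, q z * F z) / (1 - q d) := by
        rw [le_div_iff₀ hp']
        linarith
      have h5 : ∑ z ∈ B.erase d, (if z = d then 0 else h x z + h x d * (q z / (1 - q d))) * F z
          = ∑ z ∈ B.erase d, h x z * F z
            + h x d * ((∑ z ∈ B.erase d, q z * F z) / (1 - q d)) := by
        rw [Finset.sum_div, Finset.mul_sum, ← Finset.sum_add_distrib]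
        refine Finset.sum_congr rfl fun z hz => ?_
        rw [if_neg (Finset.ne_of_mem_erase hz)]
        ring
      rw [h5]
      have h6 := mul_le_mul_of_nonneg_left h4 ((hh x hx).1 d)
      simp only [if_true, zero_mul, zero_add]
      linarith

/-- Poisson kernel: exact representation of harmonic functions. -/
lemma poisson_harm (B D : Finset Z2) (hDB : D ⊆ B) (hn : ∀ z ∈ D, nbrs z ⊆ B) (x : Z2)
    (hx : x ∈ B) :
    ∃ h : Z2 → ℝ, (∀ z, 0 ≤ h z) ∧ (∀ z ∈ D, h z = 0) ∧ ∑ z ∈ B, h z = 1 ∧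
      ∀ F : Z2 → ℝ, (∀ z ∈ D, 4 * F z = nsum F z) → F x = ∑ z ∈ B, h z * F z := by
  obtain ⟨h, hh⟩ := poisson B D hDB hn
  obtain ⟨h0, h1, h2⟩ := hh x hx
  have key : ∀ F : Z2 → ℝ, (∀ z ∈ D, 4 * F z = nsum F z) → F x = ∑ z ∈ B, h x z * F z := by
    intro F hF
    apply le_antisymm (h2 F fun z hz => (hF z hz).le)
    have := h2 (fun z => - F z) (fun z hz => by
      have := hF z hz
      simp only [nsum] at this ⊢
      linarith)
    simp only [mul_neg, Finset.sum_neg_distrib] at this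
    linarith
  refine ⟨h x, h0, h1, ?_, key⟩
  have := key (fun _ => 1) (fun z _ => by simp [nsum]; norm_num)
  simpa using this.symm

/-- Walks as a subtype. -/
abbrev Walk (B : Set Z2) (t : ℕ) (x y : Z2) : Type :=
  {f : Fin (t + 1) → Z2 //
    f 0 = x ∧ f (Fin.last t) = y ∧ (∀ i, f i ∉ bdry B) ∧
    ∀ i : Fin t, Adj (f i.castSucc) (f i.succ)}

def walkEquiv (B : Set Z2) (t : ℕ) (x y : Z2) (hx : x ∉ bdry B) :
    Walk B (t + 1) x y ≃ Σ z : nbrs x, Walk B t z.1 y where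
  toFun f := ⟨⟨f.1 1, (mem_nbrs _ _).2 (by
      have := f.2.2.2.2 0
      simpa [f.2.1] using this)⟩, ⟨fun i => f.1 i.succ, by simp, f.2.2.1,
        fun i => f.2.2.2.1 _, fun i => f.2.2.2.2 i.succ⟩⟩
  invFun p := ⟨Fin.cons x p.2.1, by simp, by
      have := p.2.2.2.1
      rw [← Fin.succ_last, Fin.cons_succ, this], by
      intro i
      refine Fin.cases ?_ (fun i => ?_) i
      · simpa using hx
      · simpa using p.2.2.2.2.1 i, by
      intro i
      refine Fin.cases ?_ (fun i => ?_) i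
      · have h := (mem_nbrs _ _).1 p.1.2
        have h0 := p.2.2.1
        simp only [Fin.castSucc_zero, Fin.cons_zero, Fin.cons_succ]
        rw [h0]
        exact h
      · have := p.2.2.2.2.2 i
        rw [← Fin.succ_castSucc, Fin.cons_succ, Fin.cons_succ]
        exact this⟩
  left_inv f := by
    apply Subtype.ext
    funext i
    refine Fin.cases ?_ (fun i => ?_) i
    · simp [f.2.1]
    · simp
  right_inv p := by
    obtain ⟨⟨z, hz⟩, ⟨g, hg⟩⟩ := p
    obtain ⟨rfl, _⟩ := id hg
    rfl

lemma walk_finite (B : Set Z2) (t : ℕ) : ∀ x y, Finite (Walk B t x y) := by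
  induction t with
  | zero =>
    intro x y
    have : Subsingleton (Walk B 0 x y) := ⟨fun f g => by
      apply Subtype.ext
      funext i
      rw [Fin.fin_one_eq_zero i]
      exact f.2.1.trans g.2.1.symm⟩
    infer_instance
  | succ t ih =>
    intro x y
    by_cases hx : x ∈ bdry B
    · have : IsEmpty (Walk B (t + 1) x y) := ⟨fun f => f.2.2.2.1 0 (by rw [f.2.1]; exact hx)⟩
      infer_instance
    · have := fun z => ih z y
      exact Finite.of_equiv _ (walkEquiv B t x y hx).symm

lemma nWalks_bdry (B : Set Z2) (t : ℕ) (x y : Z2) (hx : x ∈ bdry B) : nWalks B t x y = 0 := by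
  have : IsEmpty (Walk B t x y) := ⟨fun f => f.2.2.2.1 0 (by rw [f.2.1]; exact hx)⟩
  exact Nat.card_of_isEmpty

lemma nWalks_zero (B : Set Z2) (x y : Z2) (hx : x ∉ bdry B) :
    nWalks B 0 x y = if x = y then 1 else 0 := by
  split_ifs with h
  · subst h
    have : Unique (Walk B 0 x x) :=
      { default := ⟨fun _ => x, rfl, rfl, fun _ => hx, fun i => i.elim0⟩
        uniq := fun f => by
          apply Subtype.ext
          funext i
          rw [Fin.fin_one_eq_zero i]
          exact f.2.1 }
    exact Nat.card_unique
  · have : IsEmpty (Walk B 0 x y) := ⟨fun f => h (f.2.1.symm.trans f.2.2.1)⟩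
    exact Nat.card_of_isEmpty

lemma nWalks_succ (B : Set Z2) (t : ℕ) (x y : Z2) (hx : x ∉ bdry B) :
    (nWalks B (t + 1) x y : ℝ) = nsum (fun z => (nWalks B t z y : ℝ)) x := by
  have := fun z => walk_finite B t z y
  have h : nWalks B (t + 1) x y = ∑ z ∈ nbrs x, nWalks B t z y := by
    rw [← Finset.sum_coe_sort]
    unfold nWalks
    rw [Nat.card_congr (walkEquiv B t x y hx), Nat.card_sigma]
  rw [h, ← sum_nbrs]
  push_cast
  rfl

/-- Abstract domination of the Green function. -/
lemma green_dom (V : Set Z2) (w : Z2) (f : Z2 → ℝ) (hf0 : ∀ x ∈ V, 0 ≤ f x)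
    (hf : ∀ x ∈ V, nsum f x / 4 + (if x = w then 1 else 0) ≤ f x) (T : ℕ) :
    ∀ x ∈ V, ∑ t ∈ Finset.range T, (1 / 4 : ℝ) ^ t * nWalks V t x w ≤ f x := by
  induction T with
  | zero => intro x hx; simpa using hf0 x hx
  | succ T ih =>
    intro x hx
    by_cases hb : x ∈ bdry V
    · simpa [nWalks_bdry V _ x w hb] using hf0 x hx
    · have hnb : ∀ y, Adj x y → y ∈ V := by
        intro y hy
        by_contra hyV
        exact hb ⟨hx, y, hy, hyV⟩
      rw [Finset.sum_range_succ', nWalks_zero V x w hb]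
      have e : ∑ t ∈ Finset.range T, (1 / 4 : ℝ) ^ (t + 1) * nWalks V (t + 1) x w
          = (∑ y ∈ nbrs x, ∑ t ∈ Finset.range T, (1 / 4 : ℝ) ^ t * nWalks V t y w) / 4 := by
        rw [Finset.sum_comm, Finset.sum_div]
        refine Finset.sum_congr rfl fun t _ => ?_
        rw [nWalks_succ V t x w hb, ← sum_nbrs, ← Finset.mul_sum]
        ring
      rw [e]
      have h1 : ∑ y ∈ nbrs x, ∑ t ∈ Finset.range T, (1 / 4 : ℝ) ^ t * nWalks V t y w
          ≤ nsum f x := by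
        rw [← sum_nbrs]
        exact Finset.sum_le_sum fun y hy => ih y (hnb y ((mem_nbrs _ _).1 hy))
      have h2 := hf x hx
      push_cast
      simp only [pow_zero, one_mul]
      linarith

lemma green_summable (V : Set Z2) (w : Z2) (f : Z2 → ℝ) (hf0 : ∀ x ∈ V, 0 ≤ f x)
    (hf : ∀ x ∈ V, nsum f x / 4 + (if x = w then 1 else 0) ≤ f x) (x : Z2) (hx : x ∈ V) :
    Summable (fun t : ℕ => (1 / 4 : ℝ) ^ t * nWalks V t x w) :=
  summable_of_sum_range_le (fun t => by positivity) (fun T => green_dom V w f hf0 hf T x hx)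

lemma green_le (V : Set Z2) (w : Z2) (f : Z2 → ℝ) (hf0 : ∀ x ∈ V, 0 ≤ f x)
    (hf : ∀ x ∈ V, nsum f x / 4 + (if x = w then 1 else 0) ≤ f x) (x : Z2) (hx : x ∈ V) :
    greenFn V x w ≤ f x :=
  (green_summable V w f hf0 hf x hx).tsum_le_of_sum_range_le
    (fun T => green_dom V w f hf0 hf T x hx)

lemma green_harm (V : Set Z2) (w : Z2) (f : Z2 → ℝ) (hf0 : ∀ x ∈ V, 0 ≤ f x)
    (hf : ∀ x ∈ V, nsum f x / 4 + (if x = w then 1 else 0) ≤ f x) (x : Z2) (hx : x ∈ V)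
    (hb : x ∉ bdry V) (hxw : x ≠ w) :
    4 * greenFn V x w = nsum (fun z => greenFn V z w) x := by
  have hnb : ∀ y ∈ nbrs x, y ∈ V := by
    intro y hy
    by_contra hyV
    exact hb ⟨hx, y, (mem_nbrs _ _).1 hy, hyV⟩
  rw [← sum_nbrs]
  unfold greenFn
  rw [← Summable.tsum_finsetSum (fun y hy => green_summable V w f hf0 hf y (hnb y hy)),
    (green_summable V w f hf0 hf x hx).tsum_eq_zero_add, nWalks_zero V x w hb, if_neg hxw]
  simp only [Nat.cast_zero, mul_zero, zero_add]
  rw [← tsum_mul_left]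
  refine tsum_congr fun t => ?_
  rw [nWalks_succ V t x w hb, ← sum_nbrs, ← Finset.mul_sum]
  ring

/-- The log barrier. -/
lemma log_sub (a b : ℝ) :
    4 * Real.log (a ^ 2 + b ^ 2 + 1) ≤ Real.log ((a + 1) ^ 2 + b ^ 2 + 1)
      + Real.log ((a - 1) ^ 2 + b ^ 2 + 1) + Real.log (a ^ 2 + (b + 1) ^ 2 + 1)
      + Real.log (a ^ 2 + (b - 1) ^ 2 + 1) := by
  rw [← Real.log_mul (by positivity) (by positivity), ← Real.log_mul (by positivity) (by positivity),
    ← Real.log_mul (by positivity) (by positivity)]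
  have : 4 * Real.log (a ^ 2 + b ^ 2 + 1) = Real.log ((a ^ 2 + b ^ 2 + 1) ^ 4) := by
    rw [Real.log_pow]; norm_num
  rw [this]
  apply Real.log_le_log (by positivity)
  have e : ((a + 1) ^ 2 + b ^ 2 + 1) * ((a - 1) ^ 2 + b ^ 2 + 1) * (a ^ 2 + (b + 1) ^ 2 + 1)
      * (a ^ 2 + (b - 1) ^ 2 + 1) = (a ^ 2 + b ^ 2 + 1) ^ 4 + 2 * (a ^ 2 + b ^ 2 + 1) ^ 2
        + 8 * (a ^ 2 + b ^ 2 + 1) + 5 + 16 * a ^ 2 * b ^ 2 := by ring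
  rw [e]
  have : 0 ≤ 2 * (a ^ 2 + b ^ 2 + 1) ^ 2
        + 8 * (a ^ 2 + b ^ 2 + 1) + 5 + 16 * a ^ 2 * b ^ 2 := by positivity
  linarith

noncomputable def barrier (M : ℝ) (w x : Z2) : ℝ :=
  (Real.log M - Real.log (((x.1 : ℝ) - w.1) ^ 2 + ((x.2 : ℝ) - w.2) ^ 2 + 1)) / Real.log 2

lemma barrier_super (M : ℝ) (w x : Z2) :
    nsum (barrier M w) x / 4 + (if x = w then 1 else 0) ≤ barrier M w x := by
  have hl : 0 < Real.log 2 := Real.log_pos (by norm_num)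
  split_ifs with h
  · subst h
    simp only [nsum, barrier]
    push_cast
    have e1 : (x.1 : ℝ) + 1 - x.1 = 1 := by ring
    have e2 : (x.1 : ℝ) - 1 - x.1 = -1 := by ring
    have e3 : (x.2 : ℝ) + 1 - x.2 = 1 := by ring
    have e4 : (x.2 : ℝ) - 1 - x.2 = -1 := by ring
    rw [e1, e2, e3, e4]
    norm_num
    field_simp
    ring_nf
    norm_num
  · have := log_sub ((x.1 : ℝ) - w.1) ((x.2 : ℝ) - w.2)
    simp only [nsum, barrier]
    push_cast
    have e1 : (x.1 : ℝ) + 1 - w.1 = x.1 - w.1 + 1 := by ring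
    have e2 : (x.1 : ℝ) - 1 - w.1 = x.1 - w.1 - 1 := by ring
    have e3 : (x.2 : ℝ) + 1 - w.2 = x.2 - w.2 + 1 := by ring
    have e4 : (x.2 : ℝ) - 1 - w.2 = x.2 - w.2 - 1 := by ring
    rw [e1, e2, e3, e4, ← add_div, ← add_div, ← add_div, div_div, mul_comm, ← div_div, add_zero]
    gcongr
    linarith

lemma barrier_nonneg (N : ℕ) (w x : Z2) (hw : w ∈ V5N N) (hx : x ∈ V5N N) :
    0 ≤ barrier (50 * (N : ℝ) ^ 2 + 1) w x := by
  apply div_nonneg _ (Real.log_nonneg (by norm_num))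
  rw [sub_nonneg]
  apply Real.log_le_log (by positivity)
  obtain ⟨a1, a2, a3, a4⟩ := hw
  obtain ⟨b1, b2, b3, b4⟩ := hx
  have h1 : ((x.1 : ℝ) - w.1) ^ 2 ≤ (5 * N) ^ 2 := by
    apply sq_le_sq'
    · have : -(5 * (N : ℤ)) ≤ x.1 - w.1 := by omega
      exact_mod_cast this
    · have : x.1 - w.1 ≤ 5 * (N : ℤ) := by omega
      exact_mod_cast this
  have h2 : ((x.2 : ℝ) - w.2) ^ 2 ≤ (5 * N) ^ 2 := by
    apply sq_le_sq'
    · have : -(5 * (N : ℤ)) ≤ x.2 - w.2 := by omega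
      exact_mod_cast this
    · have : x.2 - w.2 ≤ 5 * (N : ℤ) := by omega
      exact_mod_cast this
  nlinarith

lemma gauss_tail {Ω : Type*} [MeasureSpace Ω] [IsProbabilityMeasure (ℙ : Measure Ω)]
    (X : Ω → ℝ) (v : NNReal) (hX : Measure.map X (ℙ : Measure Ω) = gaussianReal 0 v) (C : ℝ)
    (hC : ∫ ω, X ω * X ω ≤ C) (t : ℝ) (ht : 0 ≤ t) (a : ℝ) :
    (ℙ : Measure Ω) {ω | a ≤ X ω} ≤ ENNReal.ofReal (Real.exp (-t * a + C * t ^ 2 / 2)) := by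
  have hm : AEMeasurable X (ℙ : Measure Ω) := by
    apply AEMeasurable.of_map_ne_zero
    rw [hX]
    exact IsProbabilityMeasure.ne_zero _
  have hv : (v : ℝ) ≤ C := by
    have h1 : Var[X; (ℙ : Measure Ω)] = v := by
      rw [← variance_id_map hm, hX, variance_id_gaussianReal]
    have h2 : (ℙ : Measure Ω)[X] = 0 := by
      have : ∫ x, x ∂(Measure.map X (ℙ : Measure Ω)) = ∫ ω, X ω := by
        rw [integral_map hm (by fun_prop)]
      rw [← this, hX, integral_id_gaussianReal]
    rw [variance_of_integral_eq_zero hm h2] at h1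
    rw [← h1]
    refine le_trans (le_of_eq ?_) hC
    refine integral_congr_ae (Eventually.of_forall fun ω => ?_)
    simp [sq]
  have hint : Integrable (fun ω => Real.exp (t * X ω)) (ℙ : Measure Ω) := by
    have := integrable_exp_mul_gaussianReal (μ := 0) (v := v) t
    rw [← hX] at this
    exact this.comp_aemeasurable hm
  have h3 := measure_ge_le_exp_mul_mgf (μ := (ℙ : Measure Ω)) (X := X) a ht hint
  rw [mgf_gaussianReal hX, ← Real.exp_add] at h3
  rw [← ofReal_measureReal]
  apply ENNReal.ofReal_le_ofReal
  refine h3.trans (Real.exp_le_exp.2 ?_)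
  have := mul_le_mul_of_nonneg_right hv (sq_nonneg t)
  linarith

lemma field_memLp {Ω : Type*} [MeasureSpace Ω] [IsProbabilityMeasure (ℙ : Measure Ω)]
    (η : Z2 → Ω → ℝ) (h : IsCenteredGaussianFamily (fun z : Z2 => η z)) (z : Z2) :
    MemLp (η z) 2 (ℙ : Measure Ω) := by
  obtain ⟨v, hv⟩ := h {z} (fun _ => 1)
  simp only [Finset.sum_singleton, one_mul] at hv
  have hv : Measure.map (η z) (ℙ : Measure Ω) = gaussianReal 0 v := hv
  have hm : AEMeasurable (η z) (ℙ : Measure Ω) := by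
    apply AEMeasurable.of_map_ne_zero
    rw [hv]
    exact IsProbabilityMeasure.ne_zero _
  have := memLp_id_gaussianReal' (μ := 0) (v := v) 2 (by norm_num)
  rw [← hv] at this
  exact this.comp_of_map hm

lemma one_point {Ω : Type*} [MeasureSpace Ω] [IsProbabilityMeasure (ℙ : Measure Ω)]
    (N K : ℕ) (R : ℤ) (hR : 1 ≤ R) (hRN : 2 * R ≤ N) (hNR : (N : ℤ) ≤ 2 * K * R)
    (η F : Z2 → Ω → ℝ) (hη : IsDGFF (V5N N) η) (u : Z2) (hu : u ∈ VN N)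
    (hF : IsHarmExt η F (boxZ u (2 * R))) (t : ℝ) (ht : 0 ≤ t) (a : ℝ) :
    (ℙ : Measure Ω) {ω | a ≤ F u ω} ≤
      ENNReal.ofReal (Real.exp (-t * a + (Real.log (200 * K ^ 2) / Real.log 2) * t ^ 2 / 2)) := by
  obtain ⟨hg, -, hcov⟩ := hη
  obtain ⟨hF1, hF2⟩ := hF
  have h2R : (2 * R) / 2 = R := by omega
  set B : Finset Z2 := Finset.Icc (u.1 - R) (u.1 + R) ×ˢ Finset.Icc (u.2 - R) (u.2 + R) with hB
  set D : Finset Z2 := Finset.Icc (u.1 - R + 1) (u.1 + R - 1) ×ˢ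
    Finset.Icc (u.2 - R + 1) (u.2 + R - 1) with hD
  have memB : ∀ z : Z2, z ∈ B ↔ (u.1 - R ≤ z.1 ∧ z.1 ≤ u.1 + R) ∧
      (u.2 - R ≤ z.2 ∧ z.2 ≤ u.2 + R) := by
    intro z; simp [hB, Finset.mem_product]
  have memD : ∀ z : Z2, z ∈ D ↔ (u.1 - R + 1 ≤ z.1 ∧ z.1 ≤ u.1 + R - 1) ∧
      (u.2 - R + 1 ≤ z.2 ∧ z.2 ≤ u.2 + R - 1) := by
    intro z; simp [hD, Finset.mem_product]
  have hDB : D ⊆ B := by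
    intro z hz
    rw [memD] at hz
    rw [memB]
    omega
  have hn : ∀ z ∈ D, nbrs z ⊆ B := by
    intro z hz w hw
    rw [memD] at hz
    rw [memB]
    simp only [nbrs, Finset.mem_insert, Finset.mem_singleton] at hw
    rcases hw with rfl | rfl | rfl | rfl <;> dsimp only <;> omega
  have memBox : ∀ z : Z2, z ∈ boxZ u (2 * R) ↔ z ∈ B := by
    intro z
    rw [memB]
    simp only [boxZ, h2R, Set.mem_setOf_eq]
    tauto
  have hDint : ∀ z ∈ D, z ∈ boxZ u (2 * R) \ bdry (boxZ u (2 * R)) := by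
    intro z hz
    refine ⟨(memBox z).2 (hDB hz), ?_⟩
    rintro ⟨-, w, hw, hwB⟩
    exact hwB ((memBox w).2 (hn z hz ((mem_nbrs _ _).2 hw)))
  have hbd : ∀ z ∈ B, z ∉ D → z ∉ boxZ u (2 * R) \ bdry (boxZ u (2 * R)) := by
    intro z hz hzD hcon
    apply hzD
    have hin : ∀ w ∈ nbrs z, w ∈ B := by
      intro w hw
      by_contra hwB
      exact hcon.2 ⟨hcon.1, w, (mem_nbrs _ _).1 hw, fun h => hwB ((memBox w).1 h)⟩
    have i1 := hin (z.1 + 1, z.2) (by simp [nbrs])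
    have i2 := hin (z.1 - 1, z.2) (by simp [nbrs])
    have i3 := hin (z.1, z.2 + 1) (by simp [nbrs])
    have i4 := hin (z.1, z.2 - 1) (by simp [nbrs])
    rw [memB] at i1 i2 i3 i4
    rw [memD]
    dsimp only at i1 i2 i3 i4
    omega
  have huB : u ∈ B := by rw [memB]; omega
  obtain ⟨u1, u2, u3, u4⟩ := hu
  have hBV : ∀ z ∈ B, z ∈ V5N N := by
    intro z hz
    rw [memB] at hz
    simp only [V5N, Set.mem_setOf_eq]
    omega
  have hDV : ∀ z ∈ D, z ∉ bdry (V5N N) := by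
    rintro z hz ⟨-, w, hw, hwV⟩
    exact hwV (hBV w (hn z hz ((mem_nbrs _ _).2 hw)))
  obtain ⟨h, h0, hhD, hsum, hrep⟩ := poisson_harm B D hDB hn u huB
  have hFrep : F u = fun ω => ∑ z ∈ B, h z * η z ω := by
    funext ω
    rw [hrep (fun z => F z ω) (fun z hz => hF2 z (hDint z hz) ω)]
    refine Finset.sum_congr rfl fun z hz => ?_
    by_cases hzD : z ∈ D
    · rw [hhD z hzD]; simp
    · skip
      rw [hF1 z (hbd z hz hzD)]
  obtain ⟨v, hv⟩ := hg B h
  have hv : Measure.map (F u) (ℙ : Measure Ω) = gaussianReal 0 v := by rw [hFrep]; exact hv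
  refine gauss_tail (F u) v hv _ ?_ t ht a
  have hmem := field_memLp η hg
  have hint : ∀ z w, Integrable (fun ω => η z ω * η w ω) (ℙ : Measure Ω) :=
    fun z w => (hmem z).integrable_mul (hmem w)
  have e1 : ∫ ω, F u ω * F u ω = ∑ w ∈ B, h w * ∑ z ∈ B, h z * greenFn (V5N N) z w := by
    have : ∀ ω, F u ω * F u ω = ∑ w ∈ B, ∑ z ∈ B, h w * (h z * (η z ω * η w ω)) := by
      intro ω
      rw [hFrep, Finset.sum_mul_sum, Finset.sum_comm]
      refine Finset.sum_congr rfl fun w _ => Finset.sum_congr rfl fun z _ => ?_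
      ring
    simp_rw [this]
    rw [integral_finset_sum _ (fun w _ => integrable_finset_sum _
      (fun z _ => ((hint z w).const_mul _).const_mul _))]
    refine Finset.sum_congr rfl fun w hw => ?_
    rw [integral_finset_sum _ (fun z _ => ((hint z w).const_mul _).const_mul _), Finset.mul_sum]
    refine Finset.sum_congr rfl fun z hz => ?_
    rw [integral_const_mul, integral_const_mul, hcov z (hBV z hz) w (hBV w hw)]
  have hRr : (1 : ℝ) ≤ R := by exact_mod_cast hR
  have hl : 0 < Real.log 2 := Real.log_pos (by norm_num)
  have hbound : ∀ w ∈ B, h w * ∑ z ∈ B, h z * greenFn (V5N N) z w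
      ≤ h w * (Real.log (200 * K ^ 2) / Real.log 2) := by
    intro w hw
    by_cases hwD : w ∈ D
    · rw [hhD w hwD]; simp
    apply mul_le_mul_of_nonneg_left _ (h0 w)
    have f0 : ∀ x ∈ V5N N, 0 ≤ barrier (50 * (N : ℝ) ^ 2 + 1) w x :=
      fun x hx => barrier_nonneg N w x (hBV w hw) hx
    have f1 : ∀ x ∈ V5N N, nsum (barrier (50 * (N : ℝ) ^ 2 + 1) w) x / 4 +
      (if x = w then 1 else 0) ≤ barrier (50 * (N : ℝ) ^ 2 + 1) w x :=
      fun x _ => barrier_super _ w x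
    rw [← hrep (fun z => greenFn (V5N N) z w) (fun z hz =>
      green_harm (V5N N) w _ f0 f1 z (hBV z (hDB hz)) (hDV z hz) (fun e => hwD (e ▸ hz)))]
    refine (green_le (V5N N) w _ f0 f1 u (hBV u huB)).trans ?_
    unfold barrier
    gcongr
    have hdist : (R : ℝ) ^ 2 ≤ ((u.1 : ℝ) - w.1) ^ 2 + ((u.2 : ℝ) - w.2) ^ 2 := by
      rw [memB] at hw
      rw [memD] at hwD
      have hc : u.1 - w.1 = R ∨ u.1 - w.1 = -R ∨ u.2 - w.2 = R ∨ u.2 - w.2 = -R := by omega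
      have : R ^ 2 ≤ (u.1 - w.1) ^ 2 + (u.2 - w.2) ^ 2 := by
        rcases hc with hc | hc | hc | hc <;> rw [hc] <;>
          nlinarith [sq_nonneg (u.1 - w.1), sq_nonneg (u.2 - w.2)]
      exact_mod_cast this
    have hN1 : (N : ℝ) ≤ 2 * K * R := by exact_mod_cast hNR
    have hK1 : (1 : ℝ) ≤ K := by
      have : 1 ≤ K := by
        rcases Nat.eq_zero_or_pos K with hK | hK
        · subst hK; simp at hNR; omega
        · exact hK
      exact_mod_cast this
    have hN2 : (N : ℝ) ^ 2 ≤ (2 * K * R) ^ 2 := by gcongr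
    rw [sub_le_iff_le_add, ← Real.log_mul (by positivity) (by positivity)]
    apply Real.log_le_log (by positivity)
    have h9 : (200 * (K : ℝ) ^ 2) * (R ^ 2 + 1) ≤ (200 * (K : ℝ) ^ 2) *
        (((u.1 : ℝ) - w.1) ^ 2 + ((u.2 : ℝ) - w.2) ^ 2 + 1) := by gcongr
    nlinarith
  rw [e1]
  refine (Finset.sum_le_sum hbound).trans (le_of_eq ?_)
  rw [← Finset.sum_mul, hsum, one_mul]

/-- **The tail term is small (last lemma of Section 4.3).** Fix `ε > 0` and
`K = 2^k`; for any choice `N = N(m)` with `K^m ≤ N(m) < K^{m+1}`,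
`P(max_{u ∈ V_N} H_{K^m}(u) ≤ ε log N) → 1` as `m → ∞`. -/
theorem tail_harmonic_extension_small :
    ∀ ε : ℝ, 0 < ε → ∀ k : ℕ, 1 ≤ k → ∀ K : ℕ, K = 2 ^ k →
      ∀ N : ℕ → ℕ, (∀ m, K ^ m ≤ N m ∧ N m < K ^ (m + 1)) →
        ∀ (Ω : Type) (_ : MeasureSpace Ω), IsProbabilityMeasure (ℙ : Measure Ω) →
          ∀ η : ℕ → Z2 → Ω → ℝ, (∀ m, IsDGFF (V5N (N m)) (η m)) →
            ∀ H : ℕ → ℤ → Z2 → Ω → ℝ,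
              (∀ m (r : ℕ) (x : Z2), ∃ F : Z2 → Ω → ℝ,
                IsHarmExt (η m) F (boxZ x ((K : ℤ) ^ r)) ∧ H m ((K : ℤ) ^ r) x = F x) →
              Tendsto
                (fun m : ℕ => ℙ {ω : Ω |
                  ∀ u ∈ VN (N m), H m ((K : ℤ) ^ m) u ω ≤ ε * Real.log (N m)})
                atTop (nhds 1) := by
  intro ε hε k hk K hK N hN Ω _ _ η hη H hH
  have hK2 : 2 ≤ K := by
    rw [hK]
    calc 2 = 2 ^ 1 := rfl
      _ ≤ 2 ^ k := Nat.pow_le_pow_right (by norm_num) hk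
  set C : ℝ := Real.log (200 * K ^ 2) / Real.log 2 with hC
  set A : ℕ → Set Ω := fun m => {ω : Ω |
    ∀ u ∈ VN (N m), H m ((K : ℤ) ^ m) u ω ≤ ε * Real.log (N m)} with hA
  have hNtop : Tendsto (fun m => (N m : ℝ)) atTop atTop := by
    refine tendsto_atTop_mono (fun m => ?_)
      (tendsto_pow_atTop_atTop_of_one_lt (show (1 : ℝ) < 2 by norm_num))
    have : 2 ^ m ≤ N m := (Nat.pow_le_pow_left hK2 m).trans (hN m).1
    exact_mod_cast this
  have hbad : ∀ m, 1 ≤ m → (ℙ : Measure Ω) (A m)ᶜ ≤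
      ENNReal.ofReal (Real.exp (C * (3 / ε) ^ 2 / 2) * (N m : ℝ)⁻¹) := by
    intro m hm
    have hNpos : 0 < N m := lt_of_lt_of_le (by positivity) (hN m).1
    obtain ⟨m', rfl⟩ : ∃ m', m = m' + 1 := ⟨m - 1, by omega⟩
    obtain ⟨k', rfl⟩ : ∃ k', k = k' + 1 := ⟨k - 1, by omega⟩
    set R : ℤ := 2 ^ k' * (K : ℤ) ^ m' with hRdef
    have hKR : (K : ℤ) ^ (m' + 1) = 2 * R := by
      rw [hRdef, pow_succ]
      nth_rewrite 2 [hK]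
      push_cast
      ring
    have hR1 : 1 ≤ R := by
      have : 0 < R := by positivity
      omega
    have hRN : 2 * R ≤ N (m' + 1) := by
      rw [← hKR]
      exact_mod_cast (hN (m' + 1)).1
    have hNR : (N (m' + 1) : ℤ) ≤ 2 * K * R := by
      have h1 := (hN (m' + 1)).2.le
      have h2 : (N (m' + 1) : ℤ) ≤ (K : ℤ) ^ (m' + 1 + 1) := by exact_mod_cast h1
      rw [pow_succ, hKR] at h2
      linarith
    set n := N (m' + 1) with hn
    set S : Finset Z2 := Finset.Ico (0 : ℤ) n ×ˢ Finset.Ico (0 : ℤ) n with hS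
    have hsub : (A (m' + 1))ᶜ ⊆ ⋃ u ∈ S, {ω | ε * Real.log n ≤ H (m' + 1) ((K : ℤ) ^ (m' + 1)) u ω} := by
      intro ω hω
      simp only [hA, Set.mem_compl_iff, Set.mem_setOf_eq, not_forall, not_le] at hω
      obtain ⟨u, hu, hlt⟩ := hω
      simp only [Set.mem_iUnion]
      refine ⟨u, ?_, hlt.le⟩
      obtain ⟨a1, a2, a3, a4⟩ := hu
      simp only [hS, Finset.mem_product, Finset.mem_Ico]
      exact ⟨⟨a1, a2⟩, a3, a4⟩
    have hone : ∀ u ∈ S, (ℙ : Measure Ω) {ω | ε * Real.log n ≤ H (m' + 1) ((K : ℤ) ^ (m' + 1)) u ω}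
        ≤ ENNReal.ofReal (Real.exp (-(3 / ε) * (ε * Real.log n) + C * (3 / ε) ^ 2 / 2)) := by
      intro u hu
      simp only [hS, Finset.mem_product, Finset.mem_Ico] at hu
      obtain ⟨F, hF, hFu⟩ := hH (m' + 1) (m' + 1) u
      rw [hFu]
      rw [hKR] at hF
      exact one_point n K R hR1 hRN hNR (η (m' + 1)) F (hη (m' + 1)) u
        ⟨hu.1.1, hu.1.2, hu.2.1, hu.2.2⟩ hF (3 / ε) (by positivity) _
    have hcard : S.card = n * n := by simp [hS]
    refine (measure_mono hsub).trans ((measure_biUnion_finset_le _ _).trans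
      ((Finset.sum_le_sum hone).trans ?_))
    rw [Finset.sum_const, hcard, nsmul_eq_mul, ← ENNReal.ofReal_natCast,
      ← ENNReal.ofReal_mul (by positivity)]
    apply ENNReal.ofReal_le_ofReal
    have hnr : (0 : ℝ) < n := by exact_mod_cast hNpos
    have e : -(3 / ε) * (ε * Real.log n) = -(3 * Real.log n) := by field_simp
    have e3 : Real.exp (3 * Real.log n) = (n : ℝ) ^ 3 := by
      rw [show 3 * Real.log n = Real.log ((n : ℝ) ^ 3) by rw [Real.log_pow]; norm_num,
        Real.exp_log (by positivity)]
    rw [e, Real.exp_add, Real.exp_neg, e3]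
    apply le_of_eq
    push_cast
    field_simp
  have hlim : Tendsto (fun m => ENNReal.ofReal
      (Real.exp (C * (3 / ε) ^ 2 / 2) * (N m : ℝ)⁻¹)) atTop (nhds 0) := by
    have := (tendsto_inv_atTop_zero.comp hNtop).const_mul (Real.exp (C * (3 / ε) ^ 2 / 2))
    rw [mul_zero] at this
    simpa using ENNReal.tendsto_ofReal this
  have hlow : Tendsto (fun m => 1 - ENNReal.ofReal
      (Real.exp (C * (3 / ε) ^ 2 / 2) * (N m : ℝ)⁻¹)) atTop (nhds 1) := by
    have := ENNReal.Tendsto.sub (tendsto_const_nhds (x := (1 : ENNReal)) (f := atTop)) hlim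
      (Or.inl ENNReal.one_ne_top)
    simpa using this
  refine tendsto_of_tendsto_of_tendsto_of_le_of_le' hlow tendsto_const_nhds ?_
    (Eventually.of_forall fun m => prob_le_one)
  filter_upwards [eventually_ge_atTop 1] with m hm
  rw [tsub_le_iff_right]
  calc (1 : ENNReal) = (ℙ : Measure Ω) (A m ∪ (A m)ᶜ) := by
        rw [Set.union_compl_self, measure_univ]
    _ ≤ (ℙ : Measure Ω) (A m) + (ℙ : Measure Ω) (A m)ᶜ := measure_union_le _ _
    _ ≤ _ := by gcongr; exact hbad m hm
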